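/- arXiv:1812.02477 — 3 statements merged into one kernel-verified Lean document; each statement's English description precedes it below -/
import Mathlib

section
/- If for some agent i and iteration κ the CBAA-M iterates satisfy v_i^κ = v* and w_i^κ = w*, then for every agent j in the closed neighborhood of i in G (including i itself), v_j^{κ+1} = v* and w_j^{κ+1} = w*. -/
open scoped Classical

/-- Closed neighborhood of `i` in `G`. -/
noncomputable def closedNbhd {S : ℕ} (G : SimpleGraph (Fin S)) (i : Fin S) :
    Finset (Fin S) :=
  Finset.univ.filter (fun h => h = i ∨ G.Adj i h)

lemma self_mem_closedNbhd {S : ℕ} (G : SimpleGraph (Fin S)) (i : Fin S) :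
    i ∈ closedNbhd G i := by simp [closedNbhd]

/-- CBAA-M Phase 1 (local auction) for agent `i`. -/
noncomputable def phase1 {S : ℕ} (c : Fin S → ℝ) (i : Fin S)
    (vw : (Fin S → Option (Fin S)) × (Fin S → ℝ)) :
    (Fin S → Option (Fin S)) × (Fin S → ℝ) :=
  if h : (∃ j, vw.1 j = some i) ∨ ¬ (∃ j, vw.2 j < c i) then vw
  else
    have hne : (Finset.univ.filter (fun j => vw.2 j < c i)).Nonempty := by
      push_neg at h
      obtain ⟨j, hj⟩ := h.2
      exact ⟨j, by simp [hj]⟩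
    let j := (Finset.univ.filter (fun j => vw.2 j < c i)).min' hne
    (Function.update vw.1 j (some i), Function.update vw.2 j (c i))

/-- One full CBAA-M iteration (Phase 1 followed by the Phase 2 max-consensus). -/
noncomputable def cbaaStep {S : ℕ} (G : SimpleGraph (Fin S)) (c : Fin S → ℝ)
    (st : Fin S → (Fin S → Option (Fin S)) × (Fin S → ℝ)) :
    Fin S → (Fin S → Option (Fin S)) × (Fin S → ℝ) := fun i =>
  (fun j =>
      (phase1 c
        (Classical.choose ((closedNbhd G i).exists_max_image
          (fun h => (phase1 c h (st h)).2 j) ⟨i, self_mem_closedNbhd G i⟩))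
        (st (Classical.choose ((closedNbhd G i).exists_max_image
          (fun h => (phase1 c h (st h)).2 j) ⟨i, self_mem_closedNbhd G i⟩)))).1 j,
   fun j =>
      (closedNbhd G i).sup' ⟨i, self_mem_closedNbhd G i⟩
        (fun h => (phase1 c h (st h)).2 j))

/-- The CBAA-M iterates: at iteration `0` all winners lists are `none` and all
bid lists are `0`. -/
noncomputable def cbaaIter {S : ℕ} (G : SimpleGraph (Fin S)) (c : Fin S → ℝ) :
    ℕ → Fin S → (Fin S → Option (Fin S)) × (Fin S → ℝ)
  | 0 => fun _ => (fun _ => none, fun _ => (0 : ℝ))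
  | (κ + 1) => cbaaStep G c (cbaaIter G c κ)

lemma mem_closedNbhd_comm {S : ℕ} {G : SimpleGraph (Fin S)} {i j : Fin S} :
    j ∈ closedNbhd G i ↔ i ∈ closedNbhd G j := by
  simp [closedNbhd, eq_comm, G.adj_comm]

/-- A pair of lists is coherent if each entry is either empty or the bid of its recorded winner,
and every entry preceding a nonempty one carries a strictly larger bid. -/
structure CoherentLists {S : ℕ} (c : Fin S → ℝ)
    (vw : (Fin S → Option (Fin S)) × (Fin S → ℝ)) : Prop where
  entry : ∀ j, (vw.1 j = none ∧ vw.2 j = 0) ∨ ∃ k, vw.1 j = some k ∧ vw.2 j = c k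
  lt_of_lt : ∀ a b, a < b → 0 < vw.2 b → vw.2 b < vw.2 a

namespace CoherentLists

variable {S : ℕ} {c : Fin S → ℝ} {vw : (Fin S → Option (Fin S)) × (Fin S → ℝ)}

lemma winner_eq (h : CoherentLists c vw) (hpos : ∀ i, 0 < c i) (hinj : Function.Injective c)
    {j k : Fin S} (hjk : vw.2 j = c k) : vw.1 j = some k := by
  rcases h.entry j with ⟨-, h0⟩ | ⟨m, hm, hw⟩
  · have := hpos k
    linarith
  · rw [hm, hinj (hw.symm.trans hjk)]

/-- Coherent bid lists are bounded entrywise by the decreasing rearrangement of the bids. -/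
lemma bid_le (h : CoherentLists c vw) (hpos : ∀ i, 0 < c i)
    (σ : Equiv.Perm (Fin S)) (hσ : StrictAnti (fun j => c (σ j))) (j : Fin S) :
    vw.2 j ≤ c (σ j) := by
  induction j using WellFoundedLT.induction with
  | ind j ih =>
    rcases h.entry j with ⟨-, h0⟩ | ⟨k, -, hw⟩
    · rw [h0]
      exact (hpos _).le
    · obtain ⟨m, rfl⟩ := σ.surjective k
      rw [hw]
      refine hσ.antitone (le_of_not_gt fun hm => ?_)
      have hlt := h.lt_of_lt m j hm (hw ▸ hpos _)
      have := ih m hm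
      linarith

lemma phase1 (h : CoherentLists c vw) (hpos : ∀ i, 0 < c i) (hinj : Function.Injective c)
    (i : Fin S) : CoherentLists c (phase1 c i vw) := by
  unfold _root_.phase1
  split_ifs with hc
  · exact h
  · push Not at hc
    obtain ⟨hi, -⟩ := hc
    extract_lets hne j
    have hj : vw.2 j < c i := by
      have := Finset.min'_mem _ hne
      simpa using this
    have hmin : ∀ a < j, c i < vw.2 a := fun a ha => by
      refine lt_of_le_of_ne (le_of_not_gt fun hlt => ?_) fun heq =>
        hi a (h.winner_eq hpos hinj heq.symm)
      exact absurd (Finset.min'_le _ a (by simpa using hlt)) (not_le.mpr ha)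
    refine ⟨fun b => ?_, fun a b hab hb => ?_⟩
    · rcases eq_or_ne b j with rfl | hbj
      · exact Or.inr ⟨i, by simp, by simp⟩
      · simpa [hbj] using h.entry b
    · rcases eq_or_ne b j with rfl | hbj
      · simpa [hab.ne] using hmin a hab
      · simp only [ne_eq, hbj, not_false_eq_true, Function.update_of_ne] at hb ⊢
        have hlt := h.lt_of_lt a b hab hb
        rcases eq_or_ne a j with rfl | haj
        · simpa using hlt.trans hj
        · simpa [haj] using hlt

end CoherentLists

/-- The consensus phase copies each entry, winner and bid together, from a neighbor maximizing
the bid. -/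
lemma exists_cbaaStep_entry {S : ℕ} (G : SimpleGraph (Fin S)) (c : Fin S → ℝ)
    (st : Fin S → (Fin S → Option (Fin S)) × (Fin S → ℝ)) (i j : Fin S) :
    ∃ h ∈ closedNbhd G i, (cbaaStep G c st i).1 j = (phase1 c h (st h)).1 j ∧
      (cbaaStep G c st i).2 j = (phase1 c h (st h)).2 j := by
  have hmax := Classical.choose_spec ((closedNbhd G i).exists_max_image
    (fun h => (phase1 c h (st h)).2 j) ⟨i, self_mem_closedNbhd G i⟩)
  exact ⟨_, hmax.1, rfl, le_antisymm (Finset.sup'_le ⟨i, self_mem_closedNbhd G i⟩ _ hmax.2)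
    (Finset.le_sup' (fun h => (phase1 c h (st h)).2 j) hmax.1)⟩

lemma phase1_bid_le_cbaaStep {S : ℕ} {G : SimpleGraph (Fin S)} (c : Fin S → ℝ)
    (st : Fin S → (Fin S → Option (Fin S)) × (Fin S → ℝ)) {i h : Fin S}
    (hh : h ∈ closedNbhd G i) (j : Fin S) :
    (phase1 c h (st h)).2 j ≤ (cbaaStep G c st i).2 j :=
  Finset.le_sup' (fun h => (phase1 c h (st h)).2 j) hh

lemma CoherentLists.cbaaStep {S : ℕ} (G : SimpleGraph (Fin S)) {c : Fin S → ℝ}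
    (hpos : ∀ i, 0 < c i) (hinj : Function.Injective c)
    {st : Fin S → (Fin S → Option (Fin S)) × (Fin S → ℝ)}
    (hst : ∀ i, CoherentLists c (st i)) (i : Fin S) :
    CoherentLists c (cbaaStep G c st i) := by
  refine ⟨fun j => ?_, fun a b hab hb => ?_⟩
  · obtain ⟨h, -, hv, hw⟩ := exists_cbaaStep_entry G c st i j
    rw [hv, hw]
    exact ((hst h).phase1 hpos hinj h).entry j
  · obtain ⟨h, hh, -, hw⟩ := exists_cbaaStep_entry G c st i b
    rw [hw] at hb ⊢
    exact (((hst h).phase1 hpos hinj h).lt_of_lt a b hab hb).trans_le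
      (phase1_bid_le_cbaaStep c st hh a)

lemma coherentLists_cbaaIter {S : ℕ} (G : SimpleGraph (Fin S)) {c : Fin S → ℝ}
    (hpos : ∀ i, 0 < c i) (hinj : Function.Injective c) (κ : ℕ) (i : Fin S) :
    CoherentLists c (cbaaIter G c κ i) := by
  induction κ generalizing i with
  | zero => exact ⟨fun _ => Or.inl ⟨rfl, rfl⟩, fun _ _ _ hb => absurd hb (lt_irrefl _)⟩
  | succ κ ih => exact CoherentLists.cbaaStep G hpos hinj ih i

/-- If some agent `i` at iteration `κ` holds the agreed
lists `v*` and `w*`, then after one more CBAA-M iteration every agent `j` in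
the closed neighborhood of `i` (including `i` itself) holds them as well. -/
theorem cbaam_agreement_propagates {S : ℕ} (hS : 1 ≤ S)
    (G : SimpleGraph (Fin S)) (hG : G.Connected)
    (c : Fin S → ℝ) (hpos : ∀ i, 0 < c i) (hinj : Function.Injective c)
    (σ : Equiv.Perm (Fin S)) (hσ : StrictAnti (fun j => c (σ j)))
    (wstar : Fin S → ℝ) (hw : ∀ j, wstar j = c (σ j))
    (vstar : Fin S → Option (Fin S)) (hv : ∀ j, vstar j = some (σ j))
    (κ : ℕ) (i : Fin S)
    (hi : (cbaaIter G c κ i).1 = vstar ∧ (cbaaIter G c κ i).2 = wstar) :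
    ∀ j ∈ closedNbhd G i,
      (cbaaIter G c (κ + 1) j).1 = vstar ∧
      (cbaaIter G c (κ + 1) j).2 = wstar := by
  intro j hj
  have hco := coherentLists_cbaaIter G hpos hinj (κ + 1) j
  have hfix : phase1 c i (cbaaIter G c κ i) = cbaaIter G c κ i :=
    dif_pos (Or.inl ⟨σ.symm i, by simp [hi.1, hv]⟩)
  have hbid : ∀ a, (cbaaIter G c (κ + 1) j).2 a = c (σ a) := fun a => by
    refine le_antisymm (hco.bid_le hpos σ hσ a) ?_
    have hle := phase1_bid_le_cbaaStep c (cbaaIter G c κ) (mem_closedNbhd_comm.mp hj) a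
    rwa [hfix, hi.2, hw] at hle
  exact ⟨funext fun a => (hco.winner_eq hpos hinj (hbid a)).trans (hv a).symm,
    funext fun a => (hbid a).trans (hw a).symm⟩
end

section
/- At every iteration κ of CBAA-M, for every agent i and every index j, either (w_i^κ)_j = 0 and (v_i^κ)_j = none, or there exists an agent g with (w_i^κ)_j = c g and (v_i^κ)_j = some g. In particular, since the bids are pairwise distinct and positive, the winners-list entry produced by the Phase-2 update is independent of the choice of maximizing neighbor h*. -/
open scoped Classical

/-- A winner/bid pair is consistent if it is empty (bid `0`, winner `none`) or records some
agent together with that agent's bid. -/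
def ConsistentEntry {S : ℕ} (c : Fin S → ℝ) (v : Option (Fin S)) (w : ℝ) : Prop :=
  (w = 0 ∧ v = none) ∨ ∃ g : Fin S, w = c g ∧ v = some g

lemma ConsistentEntry.winner_eq {S : ℕ} {c : Fin S → ℝ} (hpos : ∀ i, 0 < c i)
    (hinj : Function.Injective c) {v v' : Option (Fin S)} {w : ℝ}
    (h : ConsistentEntry c v w) (h' : ConsistentEntry c v' w) : v = v' := by
  rcases h with ⟨hw, rfl⟩ | ⟨g, hw, rfl⟩ <;> rcases h' with ⟨hw', rfl⟩ | ⟨g', hw', rfl⟩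
  · rfl
  · exact absurd (hw'.symm.trans hw) (hpos g').ne'
  · exact absurd (hw.symm.trans hw') (hpos g).ne'
  · rw [hinj (hw.symm.trans hw')]

lemma consistentEntry_phase1 {S : ℕ} {c : Fin S → ℝ}
    {vw : (Fin S → Option (Fin S)) × (Fin S → ℝ)}
    (h : ∀ j, ConsistentEntry c (vw.1 j) (vw.2 j)) (i j : Fin S) :
    ConsistentEntry c ((phase1 c i vw).1 j) ((phase1 c i vw).2 j) := by
  unfold phase1
  split_ifs with hi
  · exact h j
  · dsimp only
    generalize (Finset.univ.filter (fun j => vw.2 j < c i)).min' _ = k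
    by_cases hjk : j = k
    · subst hjk
      exact Or.inr ⟨i, by simp, by simp⟩
    · simpa [Function.update_of_ne hjk] using h j

lemma consistentEntry_cbaaStep {S : ℕ} (G : SimpleGraph (Fin S)) {c : Fin S → ℝ}
    {st : Fin S → (Fin S → Option (Fin S)) × (Fin S → ℝ)}
    (h : ∀ i j, ConsistentEntry c ((st i).1 j) ((st i).2 j)) (i j : Fin S) :
    ConsistentEntry c ((cbaaStep G c st i).1 j) ((cbaaStep G c st i).2 j) := by
  have hex := (closedNbhd G i).exists_max_image
    (fun h => (phase1 c h (st h)).2 j) ⟨i, self_mem_closedNbhd G i⟩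
  obtain ⟨hmem, hmax⟩ := Classical.choose_spec hex
  have hw : (cbaaStep G c st i).2 j =
      (phase1 c (Classical.choose hex) (st (Classical.choose hex))).2 j :=
    le_antisymm (Finset.sup'_le ⟨i, self_mem_closedNbhd G i⟩ _ hmax)
      (Finset.le_sup' (fun h => (phase1 c h (st h)).2 j) hmem)
  rw [hw]
  exact consistentEntry_phase1 (h _) _ j

lemma consistentEntry_cbaaIter {S : ℕ} (G : SimpleGraph (Fin S)) (c : Fin S → ℝ) (κ : ℕ) :
    ∀ i j, ConsistentEntry c ((cbaaIter G c κ i).1 j) ((cbaaIter G c κ i).2 j) := by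
  induction κ with
  | zero => exact fun _ _ => Or.inl ⟨rfl, rfl⟩
  | succ κ ih => exact consistentEntry_cbaaStep G ih

/-- At every iteration of CBAA-M, each entry of an agent's
lists is either empty (bid `0`, winner `none`) or consists of some agent
`g`'s bid `c g` together with the winner `some g`.  Consequently (bids being
pairwise distinct and positive), the winners-list entry produced by the
Phase-2 update does not depend on the choice of maximizing neighbor `h*`. -/
theorem cbaam_entries_consistent {S : ℕ} (hS : 1 ≤ S)
    (G : SimpleGraph (Fin S)) (hG : G.Connected)
    (c : Fin S → ℝ) (hpos : ∀ i, 0 < c i) (hinj : Function.Injective c) :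
    (∀ (κ : ℕ) (i : Fin S) (j : Fin S),
      ((cbaaIter G c κ i).2 j = 0 ∧ (cbaaIter G c κ i).1 j = none) ∨
      (∃ g : Fin S,
        (cbaaIter G c κ i).2 j = c g ∧ (cbaaIter G c κ i).1 j = some g)) ∧
    (∀ (κ : ℕ) (i : Fin S) (j : Fin S) (h₁ h₂ : Fin S),
      h₁ ∈ closedNbhd G i → h₂ ∈ closedNbhd G i →
      (∀ h ∈ closedNbhd G i,
        (phase1 c h (cbaaIter G c κ h)).2 j ≤ (phase1 c h₁ (cbaaIter G c κ h₁)).2 j) →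
      (∀ h ∈ closedNbhd G i,
        (phase1 c h (cbaaIter G c κ h)).2 j ≤ (phase1 c h₂ (cbaaIter G c κ h₂)).2 j) →
      (phase1 c h₁ (cbaaIter G c κ h₁)).1 j = (phase1 c h₂ (cbaaIter G c κ h₂)).1 j) := by
  refine ⟨consistentEntry_cbaaIter G c, fun κ i j h₁ h₂ hm₁ hm₂ hmax₁ hmax₂ => ?_⟩
  have hw := le_antisymm (hmax₂ h₁ hm₁) (hmax₁ h₂ hm₂)
  have e₁ := consistentEntry_phase1 (consistentEntry_cbaaIter G c κ h₁) h₁ j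
  have e₂ := consistentEntry_phase1 (consistentEntry_cbaaIter G c κ h₂) h₂ j
  exact e₁.winner_eq hpos hinj (hw ▸ e₂)
end

section
/- If G is the complete graph on Fin S (so that its diameter is 1), then for every iteration κ ≥ S and every agent i, the CBAA-M iterates satisfy v_i^κ = v* and w_i^κ = w*; i.e., on a fully connected network agreement is reached in at most S iterations. -/
open scoped Classical

/-- The common state of all agents on a complete graph after `κ` iterations: the first `κ` slots
hold the `κ` largest bids, sorted by `σ`, and the remaining slots are still empty. -/
noncomputable def sortedPrefix {S : ℕ} (c : Fin S → ℝ) (σ : Equiv.Perm (Fin S)) (κ : ℕ) :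
    (Fin S → Option (Fin S)) × (Fin S → ℝ) :=
  (fun j => if j.val < κ then some (σ j) else none, fun j => if j.val < κ then c (σ j) else 0)

lemma phase1_of_mem {S : ℕ} (c : Fin S → ℝ) (i : Fin S)
    (vw : (Fin S → Option (Fin S)) × (Fin S → ℝ)) (h : ∃ j, vw.1 j = some i) :
    phase1 c i vw = vw :=
  dif_pos (Or.inl h)

lemma phase1_of_isLeast {S : ℕ} (c : Fin S → ℝ) (i : Fin S)
    (vw : (Fin S → Option (Fin S)) × (Fin S → ℝ)) (h : ∀ j, vw.1 j ≠ some i)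
    {k : Fin S} (hk : IsLeast {j | vw.2 j < c i} k) :
    phase1 c i vw = (Function.update vw.1 k (some i), Function.update vw.2 k (c i)) := by
  have hcond : ¬ ((∃ j, vw.1 j = some i) ∨ ¬ ∃ j, vw.2 j < c i) := by
    push Not
    exact ⟨h, k, hk.1⟩
  have hne : (Finset.univ.filter (fun j => vw.2 j < c i)).Nonempty := ⟨k, by simpa using hk.1⟩
  have hmin : (Finset.univ.filter (fun j => vw.2 j < c i)).min' hne = k :=
    le_antisymm (Finset.min'_le _ _ (by simpa using hk.1))
      (Finset.le_min' _ _ _ fun j hj => hk.2 (by simpa using hj))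
  rw [phase1, dif_neg hcond]
  simp only [hmin]

lemma phase1_sortedPrefix_of_lt {S : ℕ} (c : Fin S → ℝ) (σ : Equiv.Perm (Fin S)) {κ : ℕ}
    {m : Fin S} (hm : m.val < κ) :
    phase1 c (σ m) (sortedPrefix c σ κ) = sortedPrefix c σ κ :=
  phase1_of_mem _ _ _ ⟨m, by simp [sortedPrefix, hm]⟩

lemma phase1_sortedPrefix_of_le {S : ℕ} {c : Fin S → ℝ} (hpos : ∀ i, 0 < c i)
    {σ : Equiv.Perm (Fin S)} (hσ : StrictAnti (fun j => c (σ j))) {k m : Fin S} (hkm : k ≤ m) :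
    phase1 c (σ m) (sortedPrefix c σ k) =
      (Function.update (sortedPrefix c σ k).1 k (some (σ m)),
        Function.update (sortedPrefix c σ k).2 k (c (σ m))) := by
  apply phase1_of_isLeast
  · intro j hj
    by_cases hjk : j < k
    · have hjm : j = m := by simpa [sortedPrefix, hjk] using hj
      exact absurd hkm (by simpa [← hjm] using hjk)
    · simp [sortedPrefix, hjk] at hj
  · refine ⟨by simp [sortedPrefix, hpos], fun j hj => ?_⟩
    by_contra! hjk
    have hlt : c (σ j) < c (σ m) := by simpa [sortedPrefix, hjk] using hj
    exact lt_asymm hlt (hσ (hjk.trans_le hkm))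

lemma closedNbhd_top {S : ℕ} (i : Fin S) :
    closedNbhd (⊤ : SimpleGraph (Fin S)) i = Finset.univ := by
  ext h
  simp [closedNbhd, eq_comm, em]

/-- On a complete graph, max-consensus copies each slot from an agent with the largest bid there. -/
lemma exists_maximizer_cbaaStep_top {S : ℕ} (c : Fin S → ℝ)
    (st : Fin S → (Fin S → Option (Fin S)) × (Fin S → ℝ)) (i j : Fin S) :
    ∃ h, (∀ h', (phase1 c h' (st h')).2 j ≤ (phase1 c h (st h)).2 j) ∧
      (cbaaStep ⊤ c st i).1 j = (phase1 c h (st h)).1 j ∧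
      (cbaaStep ⊤ c st i).2 j = (phase1 c h (st h)).2 j := by
  have hspec := Classical.choose_spec ((closedNbhd ⊤ i).exists_max_image
    (fun h => (phase1 c h (st h)).2 j) ⟨i, self_mem_closedNbhd ⊤ i⟩)
  refine ⟨_, fun h' => hspec.2 h' (by simp [closedNbhd_top]), rfl, ?_⟩
  exact le_antisymm (Finset.sup'_le ⟨i, self_mem_closedNbhd ⊤ i⟩ _ hspec.2)
    (Finset.le_sup' (fun h => (phase1 c h (st h)).2 j) hspec.1)

lemma cbaaStep_top_sortedPrefix {S : ℕ} {c : Fin S → ℝ} (hpos : ∀ i, 0 < c i)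
    {σ : Equiv.Perm (Fin S)} (hσ : StrictAnti (fun j => c (σ j))) (κ : ℕ) :
    cbaaStep ⊤ c (fun _ => sortedPrefix c σ κ) = fun _ => sortedPrefix c σ (κ + 1) := by
  funext i
  suffices h : ∀ j, (cbaaStep ⊤ c (fun _ => sortedPrefix c σ κ) i).1 j =
        (sortedPrefix c σ (κ + 1)).1 j ∧
      (cbaaStep ⊤ c (fun _ => sortedPrefix c σ κ) i).2 j = (sortedPrefix c σ (κ + 1)).2 j from
    Prod.ext (funext fun j => (h j).1) (funext fun j => (h j).2)
  intro j
  obtain ⟨h, hmax, h1, h2⟩ := exists_maximizer_cbaaStep_top c (fun _ => sortedPrefix c σ κ) i j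
  obtain ⟨m, rfl⟩ := σ.surjective h
  rw [h1, h2]
  rcases eq_or_ne j.val κ with rfl | hjκ
  · have hj := hmax (σ j)
    rw [phase1_sortedPrefix_of_le hpos hσ le_rfl] at hj
    simp only [Function.update_self] at hj
    rcases lt_or_ge m j with hmj | hjm
    · rw [phase1_sortedPrefix_of_lt c σ hmj] at hj
      exact absurd (hpos (σ j)) (not_lt.mpr (by simpa [sortedPrefix] using hj))
    · rw [phase1_sortedPrefix_of_le hpos hσ hjm] at hj
      simp only [Function.update_self] at hj
      obtain rfl : m = j := le_antisymm (hσ.le_iff_ge.mp hj) hjm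
      rw [phase1_sortedPrefix_of_le hpos hσ le_rfl]
      simp [sortedPrefix]
  · have hiff : j.val < κ + 1 ↔ j.val < κ := by omega
    rcases lt_or_ge m.val κ with hm | hm
    · rw [phase1_sortedPrefix_of_lt c σ hm]
      simp only [sortedPrefix, hiff, and_self]
    · lift κ to Fin S using hm.trans_lt m.isLt with k
      have hjk : j ≠ k := fun hjk => hjκ (congrArg Fin.val hjk)
      rw [phase1_sortedPrefix_of_le hpos hσ hm]
      simp only [Function.update_of_ne hjk, sortedPrefix, hiff, and_self]

lemma cbaaIter_top {S : ℕ} {c : Fin S → ℝ} (hpos : ∀ i, 0 < c i)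
    {σ : Equiv.Perm (Fin S)} (hσ : StrictAnti (fun j => c (σ j))) (κ : ℕ) :
    cbaaIter ⊤ c κ = fun _ => sortedPrefix c σ κ := by
  induction κ with
  | zero => simp [cbaaIter, sortedPrefix]
  | succ κ ih => rw [cbaaIter, ih, cbaaStep_top_sortedPrefix hpos hσ]

/-- On a fully connected network (the complete graph on
`Fin S`, whose diameter is `1`), CBAA-M reaches agreement in at most `S`
iterations: for every `κ ≥ S` and every agent `i`, `v_i^κ = v*` and
`w_i^κ = w*`. -/
theorem cbaam_agreement_complete_graph {S : ℕ} (hS : 1 ≤ S)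
    (c : Fin S → ℝ) (hpos : ∀ i, 0 < c i) (hinj : Function.Injective c)
    (σ : Equiv.Perm (Fin S)) (hσ : StrictAnti (fun j => c (σ j)))
    (wstar : Fin S → ℝ) (hw : ∀ j, wstar j = c (σ j))
    (vstar : Fin S → Option (Fin S)) (hv : ∀ j, vstar j = some (σ j))
    (κ : ℕ) (hκ : S ≤ κ) (i : Fin S) :
    (cbaaIter (⊤ : SimpleGraph (Fin S)) c κ i).1 = vstar ∧
    (cbaaIter (⊤ : SimpleGraph (Fin S)) c κ i).2 = wstar := by
  rw [cbaaIter_top hpos hσ]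
  constructor <;> funext j
  · simp [sortedPrefix, j.isLt.trans_le hκ, hv]
  · simp [sortedPrefix, j.isLt.trans_le hκ, hw]
end
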